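/- arXiv:1308.4732 — 3 statements merged into one kernel-verified Lean document; each statement's English description precedes it below -/
import Mathlib

section
/- Double-min duality, case m = n (primal to dual direction): Suppose m = n. If ζ̄ ∈ 𝓢ₐ⁻ is a critical point of Π^d and x̄ = Gₐ(ζ̄)⁻¹f is a local minimizer of Π on ℝⁿ, then ζ̄ is a local minimizer of Π^d on 𝓢ₐ⁻, and Π(x̄) = Π^d(ζ̄). -/
open Matrix

namespace DMD

lemma quad_line {n : ℕ} (M : Matrix (Fin n) (Fin n) ℝ) (hM : M.IsSymm) (x v : Fin n → ℝ) (t : ℝ) :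
    (x + t • v) ⬝ᵥ M.mulVec (x + t • v)
      = x ⬝ᵥ M.mulVec x + 2 * t * (v ⬝ᵥ M.mulVec x) + t ^ 2 * (v ⬝ᵥ M.mulVec v) := by
  have h : x ⬝ᵥ M.mulVec v = v ⬝ᵥ M.mulVec x := by
    rw [dotProduct_mulVec, ← mulVec_transpose, hM.eq, dotProduct_comm]
  simp only [mulVec_add, mulVec_smul, dotProduct_add, add_dotProduct, smul_dotProduct,
    dotProduct_smul, smul_eq_mul, h]
  ring

lemma quad_contDiff {n : ℕ} (M : Matrix (Fin n) (Fin n) ℝ) :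
    ContDiff ℝ 1 (fun x : Fin n → ℝ => x ⬝ᵥ M.mulVec x) := by
  unfold mulVec dotProduct
  fun_prop

/-- open mapping property of the quadratic map -/
lemma quad_open {n : ℕ} {K : Type*} [Fintype K] (hK : Fintype.card K = n)
    (M : K → Matrix (Fin n) (Fin n) ℝ) (hM : ∀ k, (M k).IsSymm) (e : K → ℝ) (x : Fin n → ℝ)
    (hinj : ∀ v : Fin n → ℝ, (∀ k, v ⬝ᵥ (M k).mulVec x = 0) → v = 0) :
    Filter.map (fun y : Fin n → ℝ => fun k => (1/2) * (y ⬝ᵥ (M k).mulVec y) + e k) (nhds x)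
      = nhds (fun k => (1/2) * (x ⬝ᵥ (M k).mulVec x) + e k) := by
  set L : (Fin n → ℝ) → (K → ℝ) :=
    fun y : Fin n → ℝ => fun k => (1/2) * (y ⬝ᵥ (M k).mulVec y) + e k with hL
  have hC : ContDiff ℝ 1 L := by
    rw [contDiff_pi]
    intro k
    exact (contDiff_const.mul (quad_contDiff (M k))).add contDiff_const
  have hs : HasStrictFDerivAt L (fderiv ℝ L x) x := hC.contDiffAt.hasStrictFDerivAt (by norm_num)
  have hval : ∀ v k, fderiv ℝ L x v k = v ⬝ᵥ (M k).mulVec x := by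
    intro v k
    have h1 : HasDerivAt (fun t : ℝ => x + t • v) v 0 := by
      simpa using ((hasDerivAt_id (0:ℝ)).smul_const v).const_add x
    have h2 : HasFDerivAt L (fderiv ℝ L x) (x + (0:ℝ) • v) := by
      simpa using hs.hasFDerivAt
    have h3 := (hasDerivAt_pi.1 (h2.comp_hasDerivAt (0:ℝ) h1)) k
    have h4 : HasDerivAt (fun t : ℝ => (1/2) * (x ⬝ᵥ (M k).mulVec x
        + 2 * t * (v ⬝ᵥ (M k).mulVec x) + t ^ 2 * (v ⬝ᵥ (M k).mulVec v)) + e k)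
        (v ⬝ᵥ (M k).mulVec x) 0 := by
      have := (((((hasDerivAt_id (0:ℝ)).const_mul 2).mul_const (v ⬝ᵥ (M k).mulVec x)).const_add
        (x ⬝ᵥ (M k).mulVec x)).add
        (((hasDerivAt_id (0:ℝ)).pow 2).mul_const (v ⬝ᵥ (M k).mulVec v))).const_mul (1/2) |>.add_const (e k)
      refine HasDerivAt.congr_deriv this ?_
      simp
    refine h3.unique (h4.congr_of_eventuallyEq (Filter.Eventually.of_forall fun t => ?_))
    simp only [hL, Function.comp_apply, quad_line _ (hM k)]
  have hinj' : Function.Injective (fderiv ℝ L x : (Fin n → ℝ) →ₗ[ℝ] (K → ℝ)) := by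
    rw [injective_iff_map_eq_zero]
    intro v hv
    apply hinj
    intro k
    rw [← hval]
    exact congrFun hv k
  have hsurj := (LinearMap.injective_iff_surjective_of_finrank_eq_finrank
    (by simp [hK])).1 hinj'
  exact hs.map_nhds_eq_of_surj (LinearMap.range_eq_top.2 hsurj)

/-- Fenchel equality for the log-sum-exp part -/
lemma lse_eq {p : ℕ} (β : ℝ) (hβ : 0 < β) (τ ξ : Fin p → ℝ) (hpos : ∀ i, 0 < τ i)
    (hsum : ∑ i, τ i < 1) (h : ∀ i, ξ i = (1/β) * Real.log (τ i / (1 - ∑ j, τ j))) :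
    (1/β) * Real.log (1 + ∑ i, Real.exp (β * ξ i))
      = ∑ i, τ i * ξ i - (1/β) * ((∑ i, τ i * Real.log (τ i))
          + (1 - ∑ i, τ i) * Real.log (1 - ∑ i, τ i)) := by
  set T := ∑ i, τ i with hT
  have hT1 : 0 < 1 - T := by linarith
  have e1 : ∀ i, Real.exp (β * ξ i) = τ i / (1 - T) := by
    intro i
    rw [h i, ← mul_assoc, mul_one_div_cancel hβ.ne', one_mul,
      Real.exp_log (div_pos (hpos i) hT1)]
  have e2 : 1 + ∑ i, Real.exp (β * ξ i) = (1 - T)⁻¹ := by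
    simp only [e1]
    rw [← Finset.sum_div, ← hT]
    field_simp
    ring
  have e3 : ∑ i, τ i * ξ i = (1/β) * (∑ i, τ i * Real.log (τ i) - T * Real.log (1 - T)) := by
    rw [hT, Finset.sum_mul, ← Finset.sum_sub_distrib, Finset.mul_sum]
    refine Finset.sum_congr rfl fun i _ => ?_
    rw [h i, Real.log_div (hpos i).ne' hT1.ne']
    ring
  rw [e2, e3, Real.log_inv]
  ring

lemma sq_eq {r : ℕ} (α : Fin r → ℝ) (hα : ∀ i, 0 < α i) (σ ξ : Fin r → ℝ)
    (h : ∀ i, ξ i = σ i / α i) :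
    ∑ i, (α i / 2) * (ξ i) ^ 2 = ∑ i, σ i * ξ i - ∑ i, (σ i)^2 / (2 * α i) := by
  rw [← Finset.sum_sub_distrib]
  refine Finset.sum_congr rfl fun i _ => ?_
  have := (hα i).ne'
  rw [h i]
  field_simp
  ring

lemma quad_G {n p r : ℕ} (A : Matrix (Fin n) (Fin n) ℝ) (Q : Fin p → Matrix (Fin n) (Fin n) ℝ)
    (B : Fin r → Matrix (Fin n) (Fin n) ℝ) (ζ : (Fin p ⊕ Fin r) → ℝ) (v x : Fin n → ℝ) :
    v ⬝ᵥ (A + ∑ i, ζ (Sum.inl i) • Q i + ∑ i, ζ (Sum.inr i) • B i).mulVec x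
      = v ⬝ᵥ A.mulVec x + ∑ i, ζ (Sum.inl i) * (v ⬝ᵥ (Q i).mulVec x)
        + ∑ i, ζ (Sum.inr i) * (v ⬝ᵥ (B i).mulVec x) := by
  simp only [add_mulVec, sum_mulVec, smul_mulVec, dotProduct_add, dotProduct_sum,
    dotProduct_smul, smul_eq_mul]

/-- A local min at zero of `t ↦ h (t^2)` cannot have negative derivative of `h`. -/
lemma no_neg (h : ℝ → ℝ) (h' : ℝ) (hd : HasDerivAt h h' 0) (hneg : h' < 0)
    (hm : ∀ᶠ t in nhds (0:ℝ), h 0 ≤ h (t ^ 2)) : False := by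
  have hs : ∀ᶠ s in nhdsWithin (0:ℝ) (Set.Ioi 0), h 0 ≤ h s := by
    have ht : Filter.Tendsto Real.sqrt (nhdsWithin (0:ℝ) (Set.Ioi 0)) (nhds 0) := by
      have := Real.continuous_sqrt.tendsto 0
      rw [Real.sqrt_zero] at this
      exact this.mono_left nhdsWithin_le_nhds
    filter_upwards [ht.eventually hm, self_mem_nhdsWithin] with s hs hs0
    rwa [Real.sq_sqrt (le_of_lt hs0)] at hs
  have hslope := (hasDerivWithinAt_iff_tendsto_slope' (by simp)).1 (hd.hasDerivWithinAt (s := Set.Ioi 0))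
  have : 0 ≤ h' := by
    refine ge_of_tendsto hslope ?_
    filter_upwards [hs, self_mem_nhdsWithin] with s hs hs0
    rw [slope_def_field]
    apply div_nonneg
    · linarith
    · simpa using le_of_lt hs0
  linarith

lemma deriv_h {p r : ℕ} (β : ℝ) (hβ : 0 < β) (α : Fin r → ℝ) (hα : ∀ i, 0 < α i)
    (τ ξ q : Fin p → ℝ) (hpos : ∀ i, 0 < τ i)
    (hsum : ∑ i, τ i < 1) (h : ∀ i, ξ i = (1/β) * Real.log (τ i / (1 - ∑ j, τ j)))
    (σ η b : Fin r → ℝ) (h2 : ∀ i, η i = σ i / α i) (a a0 : ℝ) :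
    HasDerivAt (fun s : ℝ => a0 + s * a
        + (1/β) * Real.log (1 + ∑ i, Real.exp (β * (ξ i + s * q i)))
        + ∑ i, (α i / 2) * (η i + s * b i)^2)
      (a + ∑ i, τ i * q i + ∑ i, σ i * b i) 0 := by
  set T := ∑ i, τ i with hT
  have hT1 : 0 < 1 - T := by linarith
  have e1 : ∀ i, Real.exp (β * ξ i) = τ i / (1 - T) := by
    intro i
    rw [h i, ← mul_assoc, mul_one_div_cancel hβ.ne', one_mul,
      Real.exp_log (div_pos (hpos i) hT1)]
  have e2 : 1 + ∑ i, Real.exp (β * ξ i) = (1 - T)⁻¹ := by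
    simp only [e1]
    rw [← Finset.sum_div, ← hT]
    field_simp
    ring
  have d0 : ∀ u w : ℝ, HasDerivAt (fun s : ℝ => u + s * w) w 0 := by
    intro u w
    simpa using ((hasDerivAt_id (0:ℝ)).mul_const w).const_add u
  have d1 : HasDerivAt (fun s : ℝ => 1 + ∑ i, Real.exp (β * (ξ i + s * q i)))
      (∑ i, Real.exp (β * (ξ i + 0 * q i)) * (β * q i)) 0 :=
    (HasDerivAt.fun_sum fun i _ => ((d0 (ξ i) (q i)).const_mul β).exp).const_add 1
  have d2 := (d1.log (by simp only [zero_mul, add_zero]; rw [e2]; positivity)).const_mul (1/β)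
  have d3 : HasDerivAt (fun s : ℝ => ∑ i, (α i / 2) * (η i + s * b i)^2) (∑ i, σ i * b i) 0 := by
    refine HasDerivAt.fun_sum fun i _ => ?_
    have := ((d0 (η i) (b i)).pow 2).const_mul (α i / 2)
    refine HasDerivAt.congr_deriv this ?_
    have := (hα i).ne'
    simp [h2 i]
    field_simp
  refine HasDerivAt.congr_deriv (((d0 a0 a).add d2).add d3) ?_
  congr 2
  simp only [zero_mul, add_zero]
  rw [e2]
  simp only [e1]
  rw [Finset.sum_div, Finset.mul_sum]
  refine Finset.sum_congr rfl fun i _ => ?_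
  field_simp

end DMD

theorem double_min_duality_eq_primal_to_dual
    {n p r : ℕ} (hn : 0 < n) (hp : 0 < p) (hr : 0 < r)
    (A : Matrix (Fin n) (Fin n) ℝ) (hA : A.IsSymm)
    (Q : Fin p → Matrix (Fin n) (Fin n) ℝ) (hQ : ∀ i, (Q i).IsSymm)
    (B : Fin r → Matrix (Fin n) (Fin n) ℝ) (hB : ∀ i, (B i).IsSymm)
    (f : Fin n → ℝ) (d : Fin p → ℝ) (c : Fin r → ℝ)
    (β : ℝ) (hβ : 0 < β) (α : Fin r → ℝ) (hα : ∀ i, 0 < α i)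
    (Prim : (Fin n → ℝ) → ℝ)
    (hPrim : Prim = fun x => (1/2) * (x ⬝ᵥ A.mulVec x) - f ⬝ᵥ x
        + (1/β) * Real.log (1 + ∑ i, Real.exp (β * ((1/2) * (x ⬝ᵥ (Q i).mulVec x) + d i)))
        + ∑ i, (α i / 2) * ((1/2) * (x ⬝ᵥ (B i).mulVec x) + c i)^2)
    (Ga : ((Fin p ⊕ Fin r) → ℝ) → Matrix (Fin n) (Fin n) ℝ)
    (hGa : Ga = fun ζ => A + ∑ i, ζ (Sum.inl i) • Q i + ∑ i, ζ (Sum.inr i) • B i)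
    (Dual : ((Fin p ⊕ Fin r) → ℝ) → ℝ)
    (hDual : Dual = fun ζ => -(1/2) * (f ⬝ᵥ (Ga ζ)⁻¹.mulVec f)
        - ((1/β) * ((∑ i, ζ (Sum.inl i) * Real.log (ζ (Sum.inl i)))
            + (1 - ∑ i, ζ (Sum.inl i)) * Real.log (1 - ∑ i, ζ (Sum.inl i)))
          - ∑ i, d i * ζ (Sum.inl i))
        - (∑ i, (ζ (Sum.inr i))^2 / (2 * α i) - ∑ i, c i * ζ (Sum.inr i)))
    (zb : (Fin p ⊕ Fin r) → ℝ)
    (hpos : ∀ i, 0 < zb (Sum.inl i)) (hsum : ∑ i, zb (Sum.inl i) < 1)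
    (hdet : (Ga zb).det ≠ 0)
    (hcrit1 : ∀ i, (1/2) * (f ⬝ᵥ ((Ga zb)⁻¹ * Q i * (Ga zb)⁻¹).mulVec f) + d i
        = (1/β) * Real.log (zb (Sum.inl i) / (1 - ∑ j, zb (Sum.inl j))))
    (hcrit2 : ∀ i, (1/2) * (f ⬝ᵥ ((Ga zb)⁻¹ * B i * (Ga zb)⁻¹).mulVec f) + c i
        = zb (Sum.inr i) / α i)
    (xb : Fin n → ℝ) (hxb : xb = (Ga zb)⁻¹.mulVec f)
    (hmn : p + r = n)
    (hnegdef : ∀ x : Fin n → ℝ, x ≠ 0 → x ⬝ᵥ (Ga zb).mulVec x < 0)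
    (hmin : IsLocalMin Prim xb) :
    IsLocalMinOn Dual
      {ζ : (Fin p ⊕ Fin r) → ℝ | (∀ i, 0 < ζ (Sum.inl i)) ∧ (∑ i, ζ (Sum.inl i)) < 1 ∧
        (Ga ζ).det ≠ 0 ∧ ∀ x : Fin n → ℝ, x ≠ 0 → x ⬝ᵥ (Ga ζ).mulVec x < 0} zb ∧
    Prim xb = Dual zb := by
  have hGsymm : ∀ ζ, (Ga ζ).IsSymm := by
    intro ζ
    rw [hGa]
    simp only [Matrix.IsSymm, transpose_add, transpose_sum, transpose_smul, hA.eq,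
      (hQ _).eq, (hB _).eq]
  have hGinv : ∀ ζ, (Ga ζ)⁻¹ᵀ = (Ga ζ)⁻¹ := by
    intro ζ
    rw [transpose_nonsing_inv, (hGsymm ζ).eq]
  have hGy : ∀ ζ, (Ga ζ).det ≠ 0 → (Ga ζ).mulVec ((Ga ζ)⁻¹.mulVec f) = f := by
    intro ζ hζ
    rw [mulVec_mulVec, mul_nonsing_inv _ (isUnit_iff_ne_zero.2 hζ), one_mulVec]
  have hconj : ∀ M : Matrix (Fin n) (Fin n) ℝ,
      f ⬝ᵥ ((Ga zb)⁻¹ * M * (Ga zb)⁻¹).mulVec f = xb ⬝ᵥ M.mulVec xb := by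
    intro M
    rw [hxb, ← mulVec_mulVec, ← mulVec_mulVec, dotProduct_mulVec, ← mulVec_transpose, hGinv]
  simp only [hconj] at hcrit1 hcrit2
  -- Fenchel equality
  have key : ∀ (ζ : (Fin p ⊕ Fin r) → ℝ) (x : Fin n → ℝ), (∀ i, 0 < ζ (Sum.inl i)) →
      (∑ i, ζ (Sum.inl i) < 1) →
      (∀ i, (1/2) * (x ⬝ᵥ (Q i).mulVec x) + d i
        = (1/β) * Real.log (ζ (Sum.inl i) / (1 - ∑ j, ζ (Sum.inl j)))) →
      (∀ i, (1/2) * (x ⬝ᵥ (B i).mulVec x) + c i = ζ (Sum.inr i) / α i) →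
      Prim x - Dual ζ = (1/2) * (x ⬝ᵥ (Ga ζ).mulVec x) - f ⬝ᵥ x
        + (1/2) * (f ⬝ᵥ (Ga ζ)⁻¹.mulVec f) := by
    intro ζ x h0 h1 h2 h3
    have k1 := DMD.lse_eq β hβ (fun i => ζ (Sum.inl i)) _ h0 h1 h2
    have k2 := DMD.sq_eq α hα (fun i => ζ (Sum.inr i)) _ h3
    have k3 := DMD.quad_G A Q B ζ x x
    have k4 : Ga ζ = A + ∑ i, ζ (Sum.inl i) • Q i + ∑ i, ζ (Sum.inr i) • B i := by rw [hGa]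
    rw [← k4] at k3
    have s1 : ∑ i, ζ (Sum.inl i) * ((1/2) * (x ⬝ᵥ (Q i).mulVec x) + d i)
        = (1/2) * ∑ i, ζ (Sum.inl i) * (x ⬝ᵥ (Q i).mulVec x) + ∑ i, d i * ζ (Sum.inl i) := by
      rw [Finset.mul_sum, ← Finset.sum_add_distrib]
      exact Finset.sum_congr rfl fun i _ => by ring
    have s2 : ∑ i, ζ (Sum.inr i) * ((1/2) * (x ⬝ᵥ (B i).mulVec x) + c i)
        = (1/2) * ∑ i, ζ (Sum.inr i) * (x ⬝ᵥ (B i).mulVec x) + ∑ i, c i * ζ (Sum.inr i) := by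
      rw [Finset.mul_sum, ← Finset.sum_add_distrib]
      exact Finset.sum_congr rfl fun i _ => by ring
    simp only [s1] at k1
    simp only [s2] at k2
    rw [hPrim, hDual]
    simp only
    rw [k1, k2, k3]
    ring
  have hGxb : (Ga zb).mulVec xb = f := by rw [hxb]; exact hGy zb hdet
  have heq : Prim xb = Dual zb := by
    have h := key zb xb hpos hsum hcrit1 hcrit2
    rw [← hxb, hGxb, dotProduct_comm xb f] at h
    linarith
  refine ⟨?_, heq⟩
  have hGaz : Ga zb = A + ∑ i, zb (Sum.inl i) • Q i + ∑ i, zb (Sum.inr i) • B i := by rw [hGa]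
  -- injectivity
  have hinj : ∀ v : Fin n → ℝ, (∀ k, v ⬝ᵥ ((Sum.elim Q B) k).mulVec xb = 0) → v = 0 := by
    intro v hv
    by_contra hv0
    have hvQ : ∀ i, v ⬝ᵥ (Q i).mulVec xb = 0 := fun i => hv (Sum.inl i)
    have hvB : ∀ i, v ⬝ᵥ (B i).mulVec xb = 0 := fun i => hv (Sum.inr i)
    have hvA : v ⬝ᵥ A.mulVec xb = f ⬝ᵥ v := by
      have h := DMD.quad_G A Q B zb v xb
      rw [← hGaz, hGxb] at h
      simp only [hvQ, hvB, mul_zero, Finset.sum_const_zero, add_zero] at h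
      rw [← h, dotProduct_comm]
    have hd := DMD.deriv_h β hβ α hα (fun i => zb (Sum.inl i)) _
      (fun i => (1/2) * (v ⬝ᵥ (Q i).mulVec v)) hpos hsum hcrit1
      (fun i => zb (Sum.inr i)) _ (fun i => (1/2) * (v ⬝ᵥ (B i).mulVec v)) hcrit2
      ((1/2) * (v ⬝ᵥ A.mulVec v)) ((1/2) * (xb ⬝ᵥ A.mulVec xb) - f ⬝ᵥ xb)
    have hline : ∀ t : ℝ, Prim (xb + t • v) = (fun s : ℝ =>
        ((1/2) * (xb ⬝ᵥ A.mulVec xb) - f ⬝ᵥ xb) + s * ((1/2) * (v ⬝ᵥ A.mulVec v))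
        + (1/β) * Real.log (1 + ∑ i, Real.exp (β * (((1/2) * (xb ⬝ᵥ (Q i).mulVec xb) + d i)
            + s * ((1/2) * (v ⬝ᵥ (Q i).mulVec v)))))
        + ∑ i, (α i / 2) * (((1/2) * (xb ⬝ᵥ (B i).mulVec xb) + c i)
            + s * ((1/2) * (v ⬝ᵥ (B i).mulVec v)))^2) (t ^ 2) := by
      intro t
      rw [hPrim]
      simp only [DMD.quad_line _ hA, DMD.quad_line _ (hQ _), DMD.quad_line _ (hB _), hvQ, hvB, hvA,
        dotProduct_add, dotProduct_smul, smul_eq_mul]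
      congr 1
      · congr 1
        · ring
        · congr 3
          exact Finset.sum_congr rfl fun i _ => by congr 1; ring
      · exact Finset.sum_congr rfl fun i _ => by ring
    refine DMD.no_neg _ _ hd ?_ ?_
    · have h1 := hnegdef v hv0
      rw [hGaz, DMD.quad_G] at h1
      have s1 : ∑ i, zb (Sum.inl i) * ((1/2) * (v ⬝ᵥ (Q i).mulVec v))
          = (1/2) * ∑ i, zb (Sum.inl i) * (v ⬝ᵥ (Q i).mulVec v) := by
        rw [Finset.mul_sum]
        exact Finset.sum_congr rfl fun i _ => by ring
      have s2 : ∑ i, zb (Sum.inr i) * ((1/2) * (v ⬝ᵥ (B i).mulVec v))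
          = (1/2) * ∑ i, zb (Sum.inr i) * (v ⬝ᵥ (B i).mulVec v) := by
        rw [Finset.mul_sum]
        exact Finset.sum_congr rfl fun i _ => by ring
      rw [s1, s2]
      linarith
    · have hc : Filter.Tendsto (fun t : ℝ => xb + t • v) (nhds 0) (nhds xb) := by
        have : Continuous (fun t : ℝ => xb + t • v) := by fun_prop
        simpa using this.tendsto 0
      filter_upwards [hc.eventually hmin] with t ht
      have h0 := hline 0
      rw [zero_smul, add_zero] at h0
      rw [hline t, h0] at ht
      simpa using ht
  have hopen := DMD.quad_open (K := Fin p ⊕ Fin r) (by simp [hmn]) (Sum.elim Q B)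
    (by rintro (i | i); exacts [hQ i, hB i]) (Sum.elim d c) xb hinj
  -- gradient of the conjugate
  set g : ((Fin p ⊕ Fin r) → ℝ) → ((Fin p ⊕ Fin r) → ℝ) := fun ζ =>
    Sum.elim (fun i => (1/β) * Real.log (ζ (Sum.inl i) / (1 - ∑ j, ζ (Sum.inl j))))
      (fun i => ζ (Sum.inr i) / α i) with hg
  have hT1 : 0 < 1 - ∑ j, zb (Sum.inl j) := by linarith
  have hgc : ContinuousAt g zb := by
    rw [continuousAt_pi]
    rintro (i | i)
    · simp only [hg, Sum.elim_inl]
      refine continuousAt_const.mul (ContinuousAt.log (ContinuousAt.div ?_ ?_ hT1.ne')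
        (div_pos (hpos i) hT1).ne')
      · exact continuousAt_apply _ _
      · exact continuousAt_const.sub (continuous_finsetSum _ fun j _ => continuous_apply (Sum.inl j)).continuousAt
    · simp only [hg, Sum.elim_inr]
      exact (continuousAt_apply _ _).div_const _
  have hgz : g zb = fun k => (1/2) * (xb ⬝ᵥ ((Sum.elim Q B) k).mulVec xb) + (Sum.elim d c) k := by
    funext k
    rcases k with i | i
    · exact (hcrit1 i).symm
    · exact (hcrit2 i).symm
  have himg := Filter.image_mem_map (m := fun y : Fin n → ℝ => fun k : Fin p ⊕ Fin r =>
    (1/2) * (y ⬝ᵥ ((Sum.elim Q B) k).mulVec y) + (Sum.elim d c) k) hmin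
  rw [hopen, ← hgz] at himg
  have hev := hgc.eventually himg
  refine Filter.Eventually.filter_mono nhdsWithin_le_nhds hev |>.and self_mem_nhdsWithin |>.mono ?_
  rintro ζ ⟨⟨x, hx, hxg⟩, h0, h1, h2, h3⟩
  have hx' : Prim xb ≤ Prim x := hx
  have hk := key ζ x h0 h1 (fun i => congrFun hxg (Sum.inl i)) (fun i => congrFun hxg (Sum.inr i))
  have hy := hGy ζ h2
  set y := (Ga ζ)⁻¹.mulVec f
  have hq : (x - y) ⬝ᵥ (Ga ζ).mulVec (x - y) ≤ 0 := by
    by_cases hxy : x - y = 0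
    · rw [hxy]; simp
    · exact (h3 _ hxy).le
  have hl := DMD.quad_line (Ga ζ) (hGsymm ζ) y (x - y) 1
  rw [one_smul, add_sub_cancel, hy, sub_dotProduct, dotProduct_comm x f, dotProduct_comm y f] at hl
  rw [← heq]
  linarith
end

section
/- Lemma on the primal Hessian (m < n): Suppose m < n, ζ̄ = (τ̄, σ̄) ∈ 𝓢ₐ⁻ is a critical point of Π^d and a local minimizer of Π^d on 𝓢ₐ⁻, and x̄ = Gₐ(ζ̄)⁻¹f. Then there exists a matrix L ∈ ℝ^{n×m} with rank(L) = m such that Lᵀ(Gₐ(ζ̄) + F·D·Fᵀ)L is positive semidefinite, where F = [Q₁x̄, …, Q_p x̄, B₁x̄, …, B_r x̄] ∈ ℝ^{n×m} and D ∈ ℝ^{m×m} is the block-diagonal matrix with blocks β(diag(τ̄) − τ̄τ̄ᵀ) and diag(α₁,…,α_r); here Gₐ(ζ̄) + F·D·Fᵀ is the Hessian of Π at x̄. -/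
open Matrix

open Filter Topology in
lemma aux_entropy (a h : ℝ) (ha : 0 < a) :
    Tendsto (fun t : ℝ => ((a + t * h) * Real.log (a + t * h) - a * Real.log a
      - t * (h * (Real.log a + 1))) / t ^ 2) (𝓝[>] 0) (𝓝 (h ^ 2 / (2 * a))) := by
  have hlin : ∀ t : ℝ, HasDerivAt (fun t : ℝ => a + t * h) h t := fun t => by
    simpa using ((hasDerivAt_id t).mul_const h).const_add a
  have hc : Tendsto (fun t : ℝ => a + t * h) (𝓝 0) (𝓝 a) := by
    simpa using (hlin 0).continuousAt.tendsto
  have hpos : ∀ᶠ t in 𝓝[>] (0:ℝ), 0 < a + t * h :=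
    (hc.eventually (lt_mem_nhds ha)).filter_mono nhdsWithin_le_nhds
  have hd : ∀ t : ℝ, 0 < a + t * h → HasDerivAt (fun t : ℝ =>
      (a + t * h) * Real.log (a + t * h) - a * Real.log a - t * (h * (Real.log a + 1)))
      (h * (Real.log (a + t * h) - Real.log a)) t := by
    intro t ht
    have h1 := ((hlin t).mul ((hlin t).log ht.ne')).sub_const (a * Real.log a)
    have h2 := h1.sub ((hasDerivAt_id t).mul_const (h * (Real.log a + 1)))
    refine h2.congr_deriv ?_
    rw [mul_div_cancel₀ h ht.ne']
    ring
  refine HasDerivAt.lhopital_zero_nhdsGT (f' := fun t => h * (Real.log (a + t * h) - Real.log a))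
    (g' := fun t => 2 * t) ?_ ?_ ?_ ?_ ?_ ?_
  · filter_upwards [hpos] with t ht using hd t ht
  · refine Eventually.of_forall fun t => ?_
    simpa using hasDerivAt_pow 2 t
  · filter_upwards [self_mem_nhdsWithin] with t ht
    have : (0:ℝ) < t := ht
    positivity
  · have := (hd 0 (by simpa using ha)).continuousAt.tendsto
    simp only [zero_mul, add_zero, sub_self] at this
    exact this.mono_left nhdsWithin_le_nhds
  · have : Tendsto (fun t : ℝ => t ^ 2) (𝓝 0) (𝓝 (0 ^ 2)) := (continuous_pow 2).tendsto 0
    simp only [ne_eq, OfNat.ofNat_ne_zero, not_false_eq_true, zero_pow] at this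
    exact this.mono_left nhdsWithin_le_nhds
  · have h1 : HasDerivAt (fun t : ℝ => Real.log (a + t * h)) (h / a) 0 := by
      simpa using (hlin 0).log (by simpa using ha.ne')
    have h2 := h1.tendsto_slope_zero_right
    have h3 := h2.const_mul (h / 2)
    have e : h / 2 * (h / a) = h ^ 2 / (2 * a) := by field_simp
    rw [e] at h3
    refine h3.congr' ?_
    filter_upwards [self_mem_nhdsWithin] with t ht
    have : t ≠ 0 := ne_of_gt ht
    simp
    field_simp

lemma aux_symm {n : ℕ} {M : Matrix (Fin n) (Fin n) ℝ} (hM : M.IsSymm) (x y : Fin n → ℝ) :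
    x ⬝ᵥ M *ᵥ y = y ⬝ᵥ M *ᵥ x := by
  rw [dotProduct_mulVec, ← mulVec_transpose, hM.eq, dotProduct_comm]

lemma aux_det {n : ℕ} {M : Matrix (Fin n) (Fin n) ℝ}
    (h : ∀ x : Fin n → ℝ, x ≠ 0 → x ⬝ᵥ M *ᵥ x < 0) : M.det ≠ 0 := by
  intro h0
  obtain ⟨v, hv, hv0⟩ := Matrix.exists_mulVec_eq_zero_iff.mpr h0
  have := h v hv
  rw [hv0] at this
  simp at this

lemma aux_res {n : ℕ} (G K : Matrix (Fin n) (Fin n) ℝ) (hG : G.IsSymm) (hK : K.IsSymm)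
    (hd : G.det ≠ 0) (t : ℝ) (hdt : (G + t • K).det ≠ 0) (f x : Fin n → ℝ) (hx : x = G⁻¹ *ᵥ f) :
    f ⬝ᵥ (G + t • K)⁻¹ *ᵥ f = f ⬝ᵥ x - t * (x ⬝ᵥ K *ᵥ x)
      + t ^ 2 * ((K *ᵥ x) ⬝ᵥ (G + t • K)⁻¹ *ᵥ (K *ᵥ x)) := by
  set W := G + t • K with hW
  have hWs : (W⁻¹).IsSymm := by
    rw [Matrix.IsSymm, Matrix.transpose_nonsing_inv]
    congr 1
    exact hG.add (hK.smul t)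
  have hf : f = G *ᵥ x := by
    rw [hx, mulVec_mulVec, Matrix.mul_nonsing_inv _ (isUnit_iff_ne_zero.mpr hd), one_mulVec]
  set z := W⁻¹ *ᵥ (K *ᵥ x) with hz
  have hWx : W *ᵥ x = f + t • (K *ᵥ x) := by
    rw [hW, add_mulVec, smul_mulVec, ← hf]
  have hy : W⁻¹ *ᵥ f = x - t • z := by
    have : f = W *ᵥ x - t • (K *ᵥ x) := by rw [hWx]; simp
    rw [this, mulVec_sub, mulVec_smul, mulVec_mulVec,
      Matrix.nonsing_inv_mul _ (isUnit_iff_ne_zero.mpr hdt), one_mulVec]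
  have hfz : f ⬝ᵥ z = (K *ᵥ x) ⬝ᵥ (x - t • z) := by
    rw [hz, aux_symm hWs, hy]
  rw [hy, dotProduct_sub, dotProduct_smul, hfz, dotProduct_sub, dotProduct_smul,
    dotProduct_comm (K *ᵥ x) x]
  simp only [smul_eq_mul]
  ring

open Filter Topology in
lemma aux_negdef {n : ℕ} (G K : Matrix (Fin n) (Fin n) ℝ)
    (h : ∀ x : Fin n → ℝ, x ≠ 0 → x ⬝ᵥ G *ᵥ x < 0) :
    ∀ᶠ t in 𝓝 (0:ℝ), ∀ x : Fin n → ℝ, x ≠ 0 → x ⬝ᵥ (G + t • K) *ᵥ x < 0 := by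
  have key : ∀ᶠ t in 𝓝 (0:ℝ), ∀ x ∈ Metric.sphere (0 : Fin n → ℝ) 1,
      x ⬝ᵥ (G + t • K) *ᵥ x < 0 := by
    refine (isCompact_sphere _ _).eventually_forall_of_forall_eventually ?_
    intro y hy
    have hy0 : y ≠ 0 := by
      rintro rfl
      simp at hy
    have hcont : Continuous (fun z : ℝ × (Fin n → ℝ) => z.2 ⬝ᵥ (G + z.1 • K) *ᵥ z.2) := by
      simp only [add_mulVec, smul_mulVec, dotProduct_add, dotProduct_smul]
      fun_prop
    refine hcont.continuousAt.eventually (gt_mem_nhds ?_)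
    simpa using h y hy0
  filter_upwards [key] with t ht x hx
  have hn : 0 < ‖x‖ := norm_pos_iff.mpr hx
  have := ht (‖x‖⁻¹ • x) (by simp [norm_smul, hn.ne'])
  rw [mulVec_smul, dotProduct_smul, smul_dotProduct, smul_eq_mul, smul_eq_mul, ← mul_assoc] at this
  have h2 : 0 < ‖x‖⁻¹ * ‖x‖⁻¹ := by positivity
  by_contra hcon
  push Not at hcon
  have := mul_nonneg h2.le hcon
  linarith

lemma aux_young {p r : ℕ} (τ : Fin p → ℝ) (hpos : ∀ i, 0 < τ i) (hsum : ∑ i, τ i < 1)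
    (β : ℝ) (hβ : 0 < β) (α : Fin r → ℝ) (hα : ∀ i, 0 < α i)
    (u w : Fin p ⊕ Fin r → ℝ) :
    2 * (u ⬝ᵥ w) ≤ w ⬝ᵥ (Matrix.fromBlocks
        (β • (Matrix.diagonal τ - Matrix.vecMulVec τ τ)) 0 0 (Matrix.diagonal α)) *ᵥ w
      + ((1/β) * (∑ i, u (.inl i) ^ 2 / τ i + (∑ i, u (.inl i)) ^ 2 / (1 - ∑ i, τ i))
        + ∑ i, u (.inr i) ^ 2 / α i) := by
  have young : ∀ s a b : ℝ, 0 < s → 2 * (a * b) ≤ s * b ^ 2 + a ^ 2 / s := by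
    intro s a b hs
    have : s * b ^ 2 + a ^ 2 / s - 2 * (a * b) = (s * b - a) ^ 2 / s := by field_simp; ring
    have h2 : 0 ≤ (s * b - a) ^ 2 / s := by positivity
    linarith
  set m := ∑ i, τ i * w (.inl i) with hm
  set T := ∑ i, τ i with hT
  have e1 : w ⬝ᵥ (Matrix.fromBlocks
        (β • (Matrix.diagonal τ - Matrix.vecMulVec τ τ)) 0 0 (Matrix.diagonal α)) *ᵥ w
      = β * (∑ i, τ i * w (.inl i) ^ 2 - m ^ 2) + ∑ i, α i * w (.inr i) ^ 2 := by
    rw [fromBlocks_mulVec]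
    simp only [dotProduct, Fintype.sum_sum_type, Sum.elim_inl, Sum.elim_inr, zero_mulVec, add_zero,
      zero_add, smul_mulVec, sub_mulVec, Pi.smul_apply, Pi.sub_apply, mulVec_diagonal,
      smul_eq_mul, Function.comp]
    congr 1
    · have : ∀ i, (vecMulVec τ τ *ᵥ w ∘ Sum.inl) i = τ i * m := by
        intro i
        simp only [mulVec, dotProduct, vecMulVec_apply, hm, Finset.mul_sum, Function.comp]
        exact Finset.sum_congr rfl fun j _ => by ring
      simp only [this]
      have h3 : m ^ 2 = ∑ i, τ i * w (.inl i) * m := by rw [← Finset.sum_mul, ← hm]; ring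
      rw [h3, ← Finset.sum_sub_distrib, Finset.mul_sum]
      exact Finset.sum_congr rfl fun j _ => by ring
    · exact Finset.sum_congr rfl fun j _ => by ring
  have e2 : u ⬝ᵥ w = ∑ i, u (.inl i) * w (.inl i) + ∑ i, u (.inr i) * w (.inr i) := by
    simp [dotProduct, Fintype.sum_sum_type]
  have i1 : ∑ i, 2 * (u (.inl i) * (w (.inl i) - m)) ≤
      ∑ i, (β * τ i * (w (.inl i) - m) ^ 2 + u (.inl i) ^ 2 / (β * τ i)) :=
    Finset.sum_le_sum fun i _ => young _ _ _ (mul_pos hβ (hpos i))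
  have i0 := young (β * (1 - T)) (- ∑ i, u (.inl i)) (- m) (mul_pos hβ (by linarith))
  have i2 : ∑ i, 2 * (u (.inr i) * w (.inr i)) ≤
      ∑ i, (α i * w (.inr i) ^ 2 + u (.inr i) ^ 2 / α i) :=
    Finset.sum_le_sum fun i _ => young _ _ _ (hα i)
  rw [Finset.sum_add_distrib, ← Finset.mul_sum] at i2
  have e3 : ∑ i, 2 * (u (.inl i) * (w (.inl i) - m))
      = 2 * (∑ i, u (.inl i) * w (.inl i)) - 2 * m * ∑ i, u (.inl i) := by
    rw [Finset.mul_sum, Finset.mul_sum, ← Finset.sum_sub_distrib]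
    exact Finset.sum_congr rfl fun j _ => by ring
  have e4 : ∑ i, (β * τ i * (w (.inl i) - m) ^ 2 + u (.inl i) ^ 2 / (β * τ i))
      = β * (∑ i, τ i * w (.inl i) ^ 2) - 2 * β * m * m + β * m ^ 2 * T
        + (1/β) * ∑ i, u (.inl i) ^ 2 / τ i := by
    conv_rhs => rw [hT]; arg 1; arg 1; arg 2; arg 2; rw [hm]
    simp only [Finset.mul_sum]
    rw [← Finset.sum_sub_distrib, ← Finset.sum_add_distrib, ← Finset.sum_add_distrib]
    refine Finset.sum_congr rfl fun j _ => ?_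
    have := hpos j
    field_simp
    ring
  have e5 : (- ∑ i, u (.inl i)) ^ 2 / (β * (1 - T)) = (1/β) * ((∑ i, u (.inl i)) ^ 2 / (1 - T)) := by
    have : 1 - T ≠ 0 := by linarith
    field_simp
  rw [e5] at i0
  rw [e3, e4] at i1
  rw [e1, e2]
  nlinarith [i0, i1, i2]

lemma aux_q_zero {p r : ℕ} (τ : Fin p → ℝ) (hpos : ∀ i, 0 < τ i) (hsum : ∑ i, τ i < 1)
    (β : ℝ) (hβ : 0 < β) (α : Fin r → ℝ) (hα : ∀ i, 0 < α i) (u : Fin p ⊕ Fin r → ℝ)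
    (h : (1/β) * (∑ i, u (.inl i) ^ 2 / τ i + (∑ i, u (.inl i)) ^ 2 / (1 - ∑ i, τ i))
        + ∑ i, u (.inr i) ^ 2 / α i ≤ 0) : u = 0 := by
  have n1 : ∀ i ∈ Finset.univ, 0 ≤ u (.inl i) ^ 2 / τ i :=
    fun i _ => div_nonneg (sq_nonneg _) (hpos i).le
  have n2 : ∀ i ∈ Finset.univ, 0 ≤ u (.inr i) ^ 2 / α i :=
    fun i _ => div_nonneg (sq_nonneg _) (hα i).le
  have n3 : 0 ≤ (∑ i, u (.inl i)) ^ 2 / (1 - ∑ i, τ i) :=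
    div_nonneg (sq_nonneg _) (by linarith)
  have s1 := Finset.sum_nonneg n1
  have s2 := Finset.sum_nonneg n2
  have hb : 0 < 1 / β := by positivity
  have m1 := mul_nonneg hb.le s1
  have m3 := mul_nonneg hb.le n3
  rw [mul_add] at h
  have z1 : ∑ i, u (.inl i) ^ 2 / τ i = 0 := by
    have : (1/β) * ∑ i, u (.inl i) ^ 2 / τ i = 0 := by linarith
    exact (mul_eq_zero.mp this).resolve_left hb.ne'
  have z2 : ∑ i, u (.inr i) ^ 2 / α i = 0 := by linarith
  rw [Finset.sum_eq_zero_iff_of_nonneg n1] at z1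
  rw [Finset.sum_eq_zero_iff_of_nonneg n2] at z2
  funext j
  rcases j with i | i
  · have := z1 i (Finset.mem_univ _)
    simpa [(hpos i).ne'] using this
  · have := z2 i (Finset.mem_univ _)
    simpa [(hα i).ne'] using this

lemma aux_dot {n : ℕ} {M : Matrix (Fin n) (Fin n) ℝ} (hM : M.IsSymm) (x y : Fin n → ℝ) :
    x ⬝ᵥ M *ᵥ y = (M *ᵥ x) ⬝ᵥ y := by
  rw [aux_symm hM, dotProduct_comm]

open Filter Topology

theorem lemma_primal_hessian
    {n p r : ℕ} (hn : 0 < n) (hp : 0 < p) (hr : 0 < r)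
    (A : Matrix (Fin n) (Fin n) ℝ) (hA : A.IsSymm)
    (Q : Fin p → Matrix (Fin n) (Fin n) ℝ) (hQ : ∀ i, (Q i).IsSymm)
    (B : Fin r → Matrix (Fin n) (Fin n) ℝ) (hB : ∀ i, (B i).IsSymm)
    (f : Fin n → ℝ) (d : Fin p → ℝ) (c : Fin r → ℝ)
    (β : ℝ) (hβ : 0 < β) (α : Fin r → ℝ) (hα : ∀ i, 0 < α i)
    (Prim : (Fin n → ℝ) → ℝ)
    (hPrim : Prim = fun x => (1/2) * (x ⬝ᵥ A.mulVec x) - f ⬝ᵥ x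
        + (1/β) * Real.log (1 + ∑ i, Real.exp (β * ((1/2) * (x ⬝ᵥ (Q i).mulVec x) + d i)))
        + ∑ i, (α i / 2) * ((1/2) * (x ⬝ᵥ (B i).mulVec x) + c i)^2)
    (Ga : ((Fin p ⊕ Fin r) → ℝ) → Matrix (Fin n) (Fin n) ℝ)
    (hGa : Ga = fun ζ => A + ∑ i, ζ (Sum.inl i) • Q i + ∑ i, ζ (Sum.inr i) • B i)
    (Dual : ((Fin p ⊕ Fin r) → ℝ) → ℝ)
    (hDual : Dual = fun ζ => -(1/2) * (f ⬝ᵥ (Ga ζ)⁻¹.mulVec f)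
        - ((1/β) * ((∑ i, ζ (Sum.inl i) * Real.log (ζ (Sum.inl i)))
            + (1 - ∑ i, ζ (Sum.inl i)) * Real.log (1 - ∑ i, ζ (Sum.inl i)))
          - ∑ i, d i * ζ (Sum.inl i))
        - (∑ i, (ζ (Sum.inr i))^2 / (2 * α i) - ∑ i, c i * ζ (Sum.inr i)))
    (zb : (Fin p ⊕ Fin r) → ℝ)
    (hpos : ∀ i, 0 < zb (Sum.inl i)) (hsum : ∑ i, zb (Sum.inl i) < 1)
    (hdet : (Ga zb).det ≠ 0)
    (hcrit1 : ∀ i, (1/2) * (f ⬝ᵥ ((Ga zb)⁻¹ * Q i * (Ga zb)⁻¹).mulVec f) + d i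
        = (1/β) * Real.log (zb (Sum.inl i) / (1 - ∑ j, zb (Sum.inl j))))
    (hcrit2 : ∀ i, (1/2) * (f ⬝ᵥ ((Ga zb)⁻¹ * B i * (Ga zb)⁻¹).mulVec f) + c i
        = zb (Sum.inr i) / α i)
    (xb : Fin n → ℝ) (hxb : xb = (Ga zb)⁻¹.mulVec f)
    (hmn : p + r < n)
    (hnegdef : ∀ x : Fin n → ℝ, x ≠ 0 → x ⬝ᵥ (Ga zb).mulVec x < 0)
    (hmin : IsLocalMinOn Dual
      {ζ : (Fin p ⊕ Fin r) → ℝ | (∀ i, 0 < ζ (Sum.inl i)) ∧ (∑ i, ζ (Sum.inl i)) < 1 ∧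
        (Ga ζ).det ≠ 0 ∧ ∀ x : Fin n → ℝ, x ≠ 0 → x ⬝ᵥ (Ga ζ).mulVec x < 0} zb)
    (F : Matrix (Fin n) (Fin p ⊕ Fin r) ℝ)
    (hF : F = Matrix.of fun i j =>
        (Sum.elim (fun k => (Q k).mulVec xb) (fun k => (B k).mulVec xb) j) i)
    (D : Matrix (Fin p ⊕ Fin r) (Fin p ⊕ Fin r) ℝ)
    (hD : D = Matrix.fromBlocks
        (β • (Matrix.diagonal (fun i => zb (Sum.inl i))
            - Matrix.vecMulVec (fun i => zb (Sum.inl i)) (fun i => zb (Sum.inl i))))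
        0 0 (Matrix.diagonal α)) :
    ∃ L : Matrix (Fin n) (Fin p ⊕ Fin r) ℝ, L.rank = p + r ∧
      (Lᵀ * (Ga zb + F * D * Fᵀ) * L).PosSemidef := by
  classical
  have hGs : (Ga zb).IsSymm := by
    rw [hGa]
    simp only [Matrix.IsSymm, transpose_add, transpose_sum, transpose_smul, hA.eq,
      (hQ _).eq, (hB _).eq]
  have hinv : ((Ga zb)⁻¹).IsSymm := by
    rw [Matrix.IsSymm, Matrix.transpose_nonsing_inv, hGs.eq]
  have hunit : IsUnit (Ga zb).det := isUnit_iff_ne_zero.mpr hdet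
  have hxQ : ∀ M : Matrix (Fin n) (Fin n) ℝ,
      f ⬝ᵥ ((Ga zb)⁻¹ * M * (Ga zb)⁻¹) *ᵥ f = xb ⬝ᵥ M *ᵥ xb := by
    intro M
    rw [← mulVec_mulVec, ← mulVec_mulVec, ← hxb, aux_dot hinv, ← hxb]
  set τ : Fin p → ℝ := fun i => zb (Sum.inl i) with hτ
  set T := ∑ i, zb (Sum.inl i) with hT
  have hT0 : 0 < 1 - T := by linarith
  -- second order necessary condition
  have hsecond : ∀ u : Fin p ⊕ Fin r → ℝ,
      (1/β) * (∑ i, u (.inl i) ^ 2 / τ i + (∑ i, u (.inl i)) ^ 2 / (1 - ∑ i, τ i))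
        + ∑ i, u (.inr i) ^ 2 / α i ≤ - ((F *ᵥ u) ⬝ᵥ (Ga zb)⁻¹ *ᵥ (F *ᵥ u)) := by
    intro u
    set K : Matrix (Fin n) (Fin n) ℝ :=
      ∑ i, u (Sum.inl i) • Q i + ∑ i, u (Sum.inr i) • B i with hK
    set U := ∑ i, u (Sum.inl i) with hU
    have hKs : K.IsSymm := by
      rw [hK]
      simp only [Matrix.IsSymm, transpose_add, transpose_sum, transpose_smul,
        (hQ _).eq, (hB _).eq]
    have hKx : K *ᵥ xb = F *ᵥ u := by
      rw [hK, hF, add_mulVec, sum_mulVec, sum_mulVec]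
      funext k
      simp [mulVec, dotProduct, Fintype.sum_sum_type, Finset.mul_sum, mul_comm, mul_left_comm, mul_assoc]
    have hGt : ∀ t : ℝ, Ga (zb + t • u) = Ga zb + t • K := by
      intro t
      rw [hGa, hK]
      simp only [Pi.add_apply, Pi.smul_apply, smul_eq_mul, add_smul, Finset.sum_add_distrib,
        mul_smul, smul_add, Finset.smul_sum]
      abel
    have hxK : xb ⬝ᵥ K *ᵥ xb = ∑ i, u (Sum.inl i) * (xb ⬝ᵥ Q i *ᵥ xb)
        + ∑ i, u (Sum.inr i) * (xb ⬝ᵥ B i *ᵥ xb) := by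
      rw [hK, add_mulVec, sum_mulVec, sum_mulVec, dotProduct_add, dotProduct_sum, dotProduct_sum]
      simp only [smul_mulVec, dotProduct_smul, smul_eq_mul]
    -- remainder functions
    let φ : ℝ → ℝ → ℝ → ℝ := fun a h t => ((a + t * h) * Real.log (a + t * h) - a * Real.log a
      - t * (h * (Real.log a + 1))) / t ^ 2
    have hφ : ∀ a h t, t ≠ 0 → (a + t * h) * Real.log (a + t * h)
        = a * Real.log a + t * (h * (Real.log a + 1)) + t ^ 2 * φ a h t := by
      intro a h t ht
      simp only [φ]
      field_simp
      ring
    let R : ℝ → ℝ := fun t => -(1/2) * ((K *ᵥ xb) ⬝ᵥ (Ga zb + t • K)⁻¹ *ᵥ (K *ᵥ xb))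
      - (1/β) * (∑ i, φ (zb (Sum.inl i)) (u (Sum.inl i)) t + φ (1 - T) (-U) t)
      - ∑ i, u (Sum.inr i) ^ 2 / (2 * α i)
    have hfirst : (1/2) * (xb ⬝ᵥ K *ᵥ xb)
        - (1/β) * (∑ i, u (Sum.inl i) * (Real.log (zb (Sum.inl i)) + 1)
          + (-U) * (Real.log (1 - T) + 1))
        + ∑ i, d i * u (Sum.inl i)
        - ∑ i, zb (Sum.inr i) * u (Sum.inr i) / α i + ∑ i, c i * u (Sum.inr i) = 0 := by
      have h1 : ∑ i, u (Sum.inl i) * ((1/2) * (xb ⬝ᵥ Q i *ᵥ xb) + d i)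
          = ∑ i, u (Sum.inl i) * ((1/β) * (Real.log (zb (Sum.inl i)) - Real.log (1 - T))) := by
        refine Finset.sum_congr rfl fun i _ => ?_
        have := hcrit1 i
        rw [hxQ, Real.log_div (hpos i).ne' hT0.ne'] at this
        rw [this]
      have h2 : ∑ i, u (Sum.inr i) * ((1/2) * (xb ⬝ᵥ B i *ᵥ xb) + c i)
          = ∑ i, u (Sum.inr i) * (zb (Sum.inr i) / α i) := by
        refine Finset.sum_congr rfl fun i _ => ?_
        have := hcrit2 i
        rw [hxQ] at this
        rw [this]
      have h3 : ∑ i, zb (Sum.inr i) * u (Sum.inr i) / α i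
          = ∑ i, u (Sum.inr i) * (zb (Sum.inr i) / α i) :=
        Finset.sum_congr rfl fun i _ => by ring
      have h4 : ∑ i, u (Sum.inl i) * ((1/β) * (Real.log (zb (Sum.inl i)) - Real.log (1 - T)))
          = (1/β) * (∑ i, u (Sum.inl i) * (Real.log (zb (Sum.inl i)) + 1)
          + (-U) * (Real.log (1 - T) + 1)) := by
        rw [neg_mul, hU, Finset.sum_mul, ← sub_eq_add_neg, ← Finset.sum_sub_distrib,
          Finset.mul_sum]
        exact Finset.sum_congr rfl fun i _ => by ring
      have h5 : ∑ i, u (Sum.inl i) * ((1/2) * (xb ⬝ᵥ Q i *ᵥ xb) + d i)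
          = (1/2) * ∑ i, u (Sum.inl i) * (xb ⬝ᵥ Q i *ᵥ xb) + ∑ i, d i * u (Sum.inl i) := by
        rw [Finset.mul_sum, ← Finset.sum_add_distrib]
        exact Finset.sum_congr rfl fun i _ => by ring
      have h6 : ∑ i, u (Sum.inr i) * ((1/2) * (xb ⬝ᵥ B i *ᵥ xb) + c i)
          = (1/2) * ∑ i, u (Sum.inr i) * (xb ⬝ᵥ B i *ᵥ xb) + ∑ i, c i * u (Sum.inr i) := by
        rw [Finset.mul_sum, ← Finset.sum_add_distrib]
        exact Finset.sum_congr rfl fun i _ => by ring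
      rw [hxK, h3]
      linarith
    have hexp : ∀ t : ℝ, t ≠ 0 → (Ga zb + t • K).det ≠ 0 →
        Dual (zb + t • u) - Dual zb = t ^ 2 * R t := by
      intro t ht hdt
      have s1 : ∑ i, (zb (Sum.inl i) + t * u (Sum.inl i)) = T + t * U := by
        rw [Finset.sum_add_distrib, ← Finset.mul_sum]
      have s0 : 1 - (T + t * U) = (1 - T) + t * (-U) := by ring
      have s2 : ∑ i, (zb (Sum.inl i) + t * u (Sum.inl i))
            * Real.log (zb (Sum.inl i) + t * u (Sum.inl i))
          = ∑ i, zb (Sum.inl i) * Real.log (zb (Sum.inl i))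
            + t * ∑ i, u (Sum.inl i) * (Real.log (zb (Sum.inl i)) + 1)
            + t ^ 2 * ∑ i, φ (zb (Sum.inl i)) (u (Sum.inl i)) t := by
        rw [Finset.mul_sum, Finset.mul_sum, ← Finset.sum_add_distrib, ← Finset.sum_add_distrib]
        exact Finset.sum_congr rfl fun i _ => hφ _ _ _ ht
      have s3 : ∑ i, (zb (Sum.inr i) + t * u (Sum.inr i)) ^ 2 / (2 * α i)
          = ∑ i, zb (Sum.inr i) ^ 2 / (2 * α i) + t * ∑ i, zb (Sum.inr i) * u (Sum.inr i) / α i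
            + t ^ 2 * ∑ i, u (Sum.inr i) ^ 2 / (2 * α i) := by
        rw [Finset.mul_sum, Finset.mul_sum, ← Finset.sum_add_distrib, ← Finset.sum_add_distrib]
        refine Finset.sum_congr rfl fun i _ => ?_
        have := (hα i).ne'
        field_simp
        ring
      have s4 : ∑ i, d i * (zb (Sum.inl i) + t * u (Sum.inl i))
          = ∑ i, d i * zb (Sum.inl i) + t * ∑ i, d i * u (Sum.inl i) := by
        rw [Finset.mul_sum, ← Finset.sum_add_distrib]
        exact Finset.sum_congr rfl fun i _ => by ring
      have s5 : ∑ i, c i * (zb (Sum.inr i) + t * u (Sum.inr i))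
          = ∑ i, c i * zb (Sum.inr i) + t * ∑ i, c i * u (Sum.inr i) := by
        rw [Finset.mul_sum, ← Finset.sum_add_distrib]
        exact Finset.sum_congr rfl fun i _ => by ring
      have hr1 := aux_res (Ga zb) K hGs hKs hdet t hdt f xb hxb
      rw [hDual]
      simp only [hGt, Pi.add_apply, Pi.smul_apply, smul_eq_mul, s1, s2, s3, s4, s5, s0,
        hφ (1 - T) (-U) t ht, hr1, R, ← hxb, ← hT]
      linear_combination t * hfirst
    have hlim : Tendsto R (𝓝[>] 0) (𝓝 (-(1/2) * ((K *ᵥ xb) ⬝ᵥ (Ga zb)⁻¹ *ᵥ (K *ᵥ xb))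
      - (1/β) * (∑ i, u (Sum.inl i) ^ 2 / (2 * zb (Sum.inl i)) + (-U) ^ 2 / (2 * (1 - T)))
      - ∑ i, u (Sum.inr i) ^ 2 / (2 * α i))) := by
      refine Tendsto.sub (Tendsto.sub (Tendsto.const_mul _ ?_)
        (Tendsto.const_mul _ (Tendsto.add (tendsto_finsetSum _ fun i _ => ?_) ?_)))
        tendsto_const_nhds
      · have c1 : ContinuousAt (fun t : ℝ => (Ga zb + t • K)⁻¹) 0 := by
          have c2 : ContinuousAt (fun M : Matrix (Fin n) (Fin n) ℝ => M⁻¹) (Ga zb + (0:ℝ) • K) := by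
            refine continuousAt_matrix_inv _ ?_
            simp only [zero_smul, add_zero]
            simpa using continuousAt_inv₀ hdet
          have c3 : ContinuousAt (fun t : ℝ => Ga zb + t • K) 0 := by fun_prop
          exact ContinuousAt.comp (f := fun t : ℝ => Ga zb + t • K) c2 c3
        have c4 : Continuous (fun M : Matrix (Fin n) (Fin n) ℝ =>
            (K *ᵥ xb) ⬝ᵥ M *ᵥ (K *ᵥ xb)) := by fun_prop
        have c5 := (c4.continuousAt.comp c1).tendsto
        simp only [Function.comp_def, zero_smul, add_zero] at c5
        exact c5.mono_left nhdsWithin_le_nhds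
      · exact aux_entropy _ _ (hpos i)
      · exact aux_entropy _ _ hT0
    have hline : Continuous (fun t : ℝ => zb + t • u) := by fun_prop
    have hline0 : Tendsto (fun t : ℝ => zb + t • u) (𝓝 0) (𝓝 zb) := by
      simpa using hline.tendsto 0
    have hneg := aux_negdef (Ga zb) K hnegdef
    have hev1 : ∀ᶠ t in 𝓝 (0:ℝ), ∀ i, 0 < (zb + t • u) (Sum.inl i) := by
      rw [eventually_all]
      intro i
      have : Tendsto (fun t : ℝ => (zb + t • u) (Sum.inl i)) (𝓝 0) (𝓝 (zb (Sum.inl i))) :=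
        ((continuous_apply _).tendsto _).comp hline0
      exact this.eventually (lt_mem_nhds (hpos i))
    have hev2 : ∀ᶠ t in 𝓝 (0:ℝ), ∑ i, (zb + t • u) (Sum.inl i) < 1 := by
      have : Tendsto (fun t : ℝ => ∑ i, (zb + t • u) (Sum.inl i)) (𝓝 0) (𝓝 T) :=
        tendsto_finsetSum _ fun i _ => ((continuous_apply _).tendsto _).comp hline0
      exact this.eventually (gt_mem_nhds hsum)
    have hevmin := hline0.eventually (eventually_nhdsWithin_iff.mp hmin)
    have hall : ∀ᶠ t in 𝓝[>] (0:ℝ), 0 ≤ R t := by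
      filter_upwards [self_mem_nhdsWithin, hneg.filter_mono nhdsWithin_le_nhds,
        hev1.filter_mono nhdsWithin_le_nhds, hev2.filter_mono nhdsWithin_le_nhds,
        hevmin.filter_mono nhdsWithin_le_nhds] with t ht h1 h2 h3 h4
      have ht0 : (0:ℝ) < t := ht
      have hdt := aux_det h1
      have h5 := h4 ⟨h2, h3, by rw [hGt]; exact hdt, by rw [hGt]; exact h1⟩
      have h6 := hexp t ht0.ne' hdt
      have h7 : 0 ≤ t ^ 2 * R t := by linarith
      exact nonneg_of_mul_nonneg_right h7 (by positivity)
    have hfin := ge_of_tendsto hlim hall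
    have g1 : ∑ i, u (Sum.inl i) ^ 2 / (2 * zb (Sum.inl i))
        = (1/2) * ∑ i, u (Sum.inl i) ^ 2 / τ i := by
      rw [Finset.mul_sum]
      refine Finset.sum_congr rfl fun i _ => ?_
      simp only [hτ]
      have := (hpos i).ne'
      field_simp
    have g2 : ∑ i, u (Sum.inr i) ^ 2 / (2 * α i) = (1/2) * ∑ i, u (Sum.inr i) ^ 2 / α i := by
      rw [Finset.mul_sum]
      refine Finset.sum_congr rfl fun i _ => ?_
      have := (hα i).ne'
      field_simp
    have g3 : (-U) ^ 2 / (2 * (1 - T)) = (1/2) * (U ^ 2 / (1 - T)) := by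
      have := hT0.ne'
      field_simp
    rw [g1, g2, g3, hKx] at hfin
    have g4 : ∑ i, τ i = T := rfl
    rw [g4]
    linarith
  -- conclusion
  have hGi : Ga zb * (Ga zb)⁻¹ = 1 := Matrix.mul_nonsing_inv _ hunit
  refine ⟨(Ga zb)⁻¹ * F, ?_, ?_⟩
  · have hinj : Function.Injective ((Ga zb)⁻¹ * F).mulVecLin := by
      rw [← LinearMap.ker_eq_bot, LinearMap.ker_eq_bot']
      intro u hu
      rw [mulVecLin_apply, ← mulVec_mulVec] at hu
      have := hsecond u
      rw [hu, dotProduct_zero, neg_zero] at this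
      exact aux_q_zero τ hpos hsum β hβ α hα u this
    have := LinearMap.finrank_range_of_inj hinj
    rw [Matrix.rank, this]
    simp
  · have hDs : Dᵀ = D := by
      rw [hD, fromBlocks_transpose]
      simp [transpose_vecMulVec]
    refine Matrix.PosSemidef.of_dotProduct_mulVec_nonneg ?_ fun u => ?_
    · rw [Matrix.IsHermitian, conjTranspose_eq_transpose_of_trivial]
      simp only [transpose_mul, transpose_add, transpose_transpose, hDs, hGs.eq, Matrix.mul_assoc]
    · set y := (Ga zb)⁻¹ *ᵥ (F *ᵥ u) with hy
      have hGy : Ga zb *ᵥ y = F *ᵥ u := by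
        rw [hy, mulVec_mulVec, hGi, one_mulVec]
      have hYg := aux_young τ hpos hsum β hβ α hα u (-(Fᵀ *ᵥ y))
      rw [← hD] at hYg
      have e1 : u ⬝ᵥ (-(Fᵀ *ᵥ y)) = - ((F *ᵥ u) ⬝ᵥ y) := by
        rw [dotProduct_neg, dotProduct_mulVec, vecMul_transpose]
      have e2 : (-(Fᵀ *ᵥ y)) ⬝ᵥ D *ᵥ (-(Fᵀ *ᵥ y)) = (Fᵀ *ᵥ y) ⬝ᵥ D *ᵥ (Fᵀ *ᵥ y) := by
        simp [mulVec_neg]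
      have e3 : star u ⬝ᵥ ((((Ga zb)⁻¹ * F)ᵀ * (Ga zb + F * D * Fᵀ) * ((Ga zb)⁻¹ * F)) *ᵥ u)
          = (F *ᵥ u) ⬝ᵥ y + (Fᵀ *ᵥ y) ⬝ᵥ D *ᵥ (Fᵀ *ᵥ y) := by
        have hL : ((Ga zb)⁻¹ * F) *ᵥ u = y := by rw [← mulVec_mulVec]
        rw [star_trivial, ← mulVec_mulVec, hL, ← mulVec_mulVec, dotProduct_mulVec u,
          vecMul_transpose, hL, add_mulVec, dotProduct_add, hGy, dotProduct_comm y]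
        congr 1
        rw [← mulVec_mulVec, ← mulVec_mulVec, dotProduct_mulVec y, ← mulVec_transpose]
      have := hsecond u
      rw [e1, e2] at hYg
      rw [e3]
      linarith
end

section
/- Lemma on the dual Hessian (m > n): Suppose m > n, ζ̄ = (τ̄, σ̄) ∈ 𝓢ₐ⁻ is a critical point of Π^d, and x̄ = Gₐ(ζ̄)⁻¹f is a local minimizer of Π on ℝⁿ. Then there exists a matrix P ∈ ℝ^{m×n} with rank(P) = n such that Pᵀ(−FᵀGₐ(ζ̄)⁻¹F − D⁻¹)P is positive semidefinite, where F = [Q₁x̄, …, Q_p x̄, B₁x̄, …, B_r x̄] ∈ ℝ^{n×m} and D ∈ ℝ^{m×m} is the block-diagonal matrix with blocks β(diag(τ̄) − τ̄τ̄ᵀ) and diag(α₁,…,α_r); here −FᵀGₐ(ζ̄)⁻¹F − D⁻¹ is the Hessian of Π^d at ζ̄. -/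
open Matrix

lemma second_order_nec (φ φ' : ℝ → ℝ) (c : ℝ) (h1 : ∀ t, HasDerivAt φ (φ' t) t)
    (h2 : HasDerivAt φ' c 0) (hm : IsLocalMin φ 0) : 0 ≤ c := by
  by_contra hc
  push Not at hc
  have hd : deriv φ = φ' := funext fun t => (h1 t).deriv
  have hdd : deriv (deriv φ) 0 = c := by rw [hd]; exact h2.deriv
  have hM : IsLocalMax φ 0 :=
    isLocalMax_of_deriv_deriv_neg (by rw [hdd]; exact hc) hm.deriv_eq_zero
      (h1 0).continuousAt
  have he : φ =ᶠ[nhds 0] fun _ => φ 0 := by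
    filter_upwards [hm, hM] with t a b
    exact le_antisymm b a
  have := he.deriv.deriv_eq
  rw [hdd] at this
  simp at this
  linarith

lemma second_order_line {p r : ℕ} (β : ℝ) (hβ : 0 < β) (α : Fin r → ℝ)
    (a0 a1 a2 : ℝ) (q b e : Fin p → ℝ) (u g h : Fin r → ℝ)
    (hm : IsLocalMin (fun t : ℝ => a0 + a1 * t + a2 * t ^ 2 / 2
        + (1/β) * Real.log (1 + ∑ i, Real.exp (β * (q i + b i * t + e i * t ^ 2 / 2)))
        + ∑ i, (α i / 2) * (u i + g i * t + h i * t ^ 2 / 2) ^ 2) 0)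
    (S : ℝ) (hS : S = 1 + ∑ i, Real.exp (β * q i)) :
    0 ≤ a2 + ((∑ i, Real.exp (β * q i) * (β * b i ^ 2 + e i)) * S
        - (∑ i, Real.exp (β * q i) * b i) * (β * ∑ i, Real.exp (β * q i) * b i)) / S ^ 2
        + ∑ i, α i * (g i ^ 2 + u i * h i) := by
  have hq : ∀ (x y z t : ℝ), HasDerivAt (fun t : ℝ => x + y * t + z * t ^ 2 / 2) (y + z * t) t := by
    intro x y z t
    have := (((hasDerivAt_id t).const_mul y).const_add x).add
      ((((hasDerivAt_id t).pow 2).const_mul z).div_const 2)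
    refine (this.congr_deriv ?_)
    simp; ring
  have hl : ∀ (y z t : ℝ), HasDerivAt (fun t : ℝ => y + z * t) z t := by
    intro y z t
    simpa using ((hasDerivAt_id t).const_mul z).const_add y
  have hE : ∀ i t, HasDerivAt (fun t : ℝ => Real.exp (β * (q i + b i * t + e i * t ^ 2 / 2)))
      (Real.exp (β * (q i + b i * t + e i * t ^ 2 / 2)) * (β * (b i + e i * t))) t :=
    fun i t => ((hq (q i) (b i) (e i) t).const_mul β).exp
  have hSd : ∀ t, HasDerivAt
      (fun t : ℝ => 1 + ∑ i, Real.exp (β * (q i + b i * t + e i * t ^ 2 / 2)))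
      (∑ i, Real.exp (β * (q i + b i * t + e i * t ^ 2 / 2)) * (β * (b i + e i * t))) t :=
    fun t => (HasDerivAt.fun_sum fun i _ => hE i t).const_add 1
  have hSpos : ∀ t : ℝ, 0 < 1 + ∑ i, Real.exp (β * (q i + b i * t + e i * t ^ 2 / 2)) := by
    intro t
    have : 0 ≤ ∑ i, Real.exp (β * (q i + b i * t + e i * t ^ 2 / 2)) :=
      Finset.sum_nonneg fun i _ => (Real.exp_pos _).le
    linarith
  refine second_order_nec _ (fun t => a1 + a2 * t
      + (∑ i, Real.exp (β * (q i + b i * t + e i * t ^ 2 / 2)) * (b i + e i * t))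
        / (1 + ∑ i, Real.exp (β * (q i + b i * t + e i * t ^ 2 / 2)))
      + ∑ i, α i * ((u i + g i * t + h i * t ^ 2 / 2) * (g i + h i * t))) _ ?_ ?_ hm
  · intro t
    have := ((hq a0 a1 a2 t).add (((hSd t).log (hSpos t).ne').const_mul (1/β))).add
      (HasDerivAt.fun_sum (u := Finset.univ) fun i _ =>
        ((hq (u i) (g i) (h i) t).pow 2).const_mul (α i / 2))
    refine this.congr_deriv ?_
    congr 1
    · congr 1
      rw [show (∑ i, Real.exp (β * (q i + b i * t + e i * t ^ 2 / 2)) * (β * (b i + e i * t)))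
        = β * ∑ i, Real.exp (β * (q i + b i * t + e i * t ^ 2 / 2)) * (b i + e i * t) by
          rw [Finset.mul_sum]; exact Finset.sum_congr rfl fun i _ => by ring]
      rw [mul_div_assoc, ← mul_assoc, one_div_mul_cancel hβ.ne', one_mul]
    · refine Finset.sum_congr rfl fun i _ => ?_
      simp; ring
  · have hN : HasDerivAt
        (fun t => ∑ i, Real.exp (β * (q i + b i * t + e i * t ^ 2 / 2)) * (b i + e i * t)) _ 0 :=
      HasDerivAt.fun_sum (u := Finset.univ) fun i _ => (hE i 0).mul (hl (b i) (e i) 0)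
    have := ((hl a1 a2 0).add (hN.div (hSd 0) (hSpos 0).ne')).add
      (HasDerivAt.fun_sum (u := Finset.univ) fun i _ =>
        ((hq (u i) (g i) (h i) 0).mul (hl (g i) (h i) 0)).const_mul (α i))
    refine this.congr_deriv ?_
    simp only [mul_zero, add_zero, ne_eq, OfNat.ofNat_ne_zero, not_false_eq_true, zero_pow,
      zero_div, ← hS]
    congr 1
    · congr 3
      · congr 1
        exact Finset.sum_congr rfl fun i _ => by ring
      · congr 1
        rw [Finset.mul_sum]
        exact Finset.sum_congr rfl fun i _ => by ring
    · exact Finset.sum_congr rfl fun i _ => by ring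

lemma quad_line {n : ℕ} (M : Matrix (Fin n) (Fin n) ℝ) (hM : M.IsSymm) (x v : Fin n → ℝ) (t : ℝ) :
    (x + t • v) ⬝ᵥ M.mulVec (x + t • v)
      = x ⬝ᵥ M.mulVec x + 2 * (v ⬝ᵥ M.mulVec x) * t + (v ⬝ᵥ M.mulVec v) * t ^ 2 := by
  have hs : x ⬝ᵥ M.mulVec v = v ⬝ᵥ M.mulVec x := by
    rw [dotProduct_mulVec, ← mulVec_transpose, hM.eq, dotProduct_comm]
  simp only [mulVec_add, mulVec_smul, add_dotProduct, dotProduct_add, smul_dotProduct,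
    dotProduct_smul, smul_eq_mul, hs]
  ring

lemma inv_order {n : ℕ} {ι : Type*} [Fintype ι] [DecidableEq ι]
    (G : Matrix (Fin n) (Fin n) ℝ) (hG : G.IsSymm) (hdet : G.det ≠ 0)
    (hneg : ∀ x : Fin n → ℝ, x ≠ 0 → x ⬝ᵥ G.mulVec x < 0)
    (F : Matrix (Fin n) ι ℝ) (D : Matrix ι ι ℝ) (hD : D.IsSymm) (hDdet : IsUnit D.det)
    (hH : ∀ v : Fin n → ℝ, 0 ≤ v ⬝ᵥ G.mulVec v + v ⬝ᵥ (F * D * Fᵀ).mulVec v) :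
    ∃ P : Matrix ι (Fin n) ℝ, P.rank = n ∧
      (Pᵀ * (-(Fᵀ * G⁻¹ * F) - D⁻¹) * P).PosSemidef := by
  refine ⟨D * Fᵀ, ?_, ?_⟩
  · have hinj : Function.Injective (D * Fᵀ).mulVec := by
      rw [← Matrix.coe_mulVecLin, ← LinearMap.ker_eq_bot, LinearMap.ker_eq_bot']
      intro v hv
      rw [Matrix.mulVecLin_apply] at hv
      by_contra hne
      have h1 := hH v
      have h2 := hneg v hne
      rw [Matrix.mul_assoc, ← mulVec_mulVec, hv] at h1
      simp at h1
      linarith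
    rw [Matrix.rank, LinearMap.finrank_range_of_inj (by rw [Matrix.coe_mulVecLin]; exact hinj)]
    simp
  · set M := F * D * Fᵀ with hMdef
    have hMs : Mᵀ = M := by
      rw [hMdef]; simp [Matrix.transpose_mul, hD.eq, Matrix.mul_assoc]
    have hGi : (G⁻¹)ᵀ = G⁻¹ := by rw [transpose_nonsing_inv, hG.eq]
    have hGu : IsUnit G.det := isUnit_iff_ne_zero.mpr hdet
    have key : (D * Fᵀ)ᵀ * (-(Fᵀ * G⁻¹ * F) - D⁻¹) * (D * Fᵀ) = -(M * G⁻¹ * M) - M := by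
      have h1 : F * D * D⁻¹ * (D * Fᵀ) = M := by
        rw [Matrix.mul_assoc F D, Matrix.mul_nonsing_inv _ hDdet, Matrix.mul_one, hMdef,
          Matrix.mul_assoc]
      rw [transpose_mul, transpose_transpose, hD.eq, Matrix.mul_sub, Matrix.sub_mul, h1]
      congr 1
      simp [hMdef, Matrix.mul_assoc]
    rw [key]
    refine Matrix.PosSemidef.of_dotProduct_mulVec_nonneg ?_ ?_
    · rw [Matrix.IsHermitian, conjTranspose_eq_transpose_of_trivial]
      simp [transpose_mul, hMs, hGi, Matrix.mul_assoc]
    · intro v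
      rw [star_trivial]
      set w := -(G⁻¹.mulVec (M.mulVec v)) with hw
      have hGw : G.mulVec w = - M.mulVec v := by
        rw [hw, mulVec_neg, mulVec_mulVec, Matrix.mul_nonsing_inv _ hGu, one_mulVec]
      have e1 : v ⬝ᵥ (-(M * G⁻¹ * M) - M).mulVec v = (M.mulVec v) ⬝ᵥ w - v ⬝ᵥ M.mulVec v := by
        rw [sub_mulVec, neg_mulVec, dotProduct_sub, Matrix.mul_assoc M, ← mulVec_mulVec v M,
          ← mulVec_mulVec v G⁻¹, hw, dotProduct_neg, dotProduct_neg, dotProduct_mulVec v M,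
          ← mulVec_transpose, hMs]
      have e2 := quad_line G hG w v (-1)
      have e3 : (w + (-1 : ℝ) • v) ⬝ᵥ G.mulVec (w + (-1 : ℝ) • v) ≤ 0 := by
        by_cases h0 : w + (-1 : ℝ) • v = 0
        · rw [h0]; simp
        · exact (hneg _ h0).le
      rw [e2, hGw] at e3
      simp only [dotProduct_neg] at e3
      have e4 : w ⬝ᵥ M.mulVec v = M.mulVec v ⬝ᵥ w := dotProduct_comm _ _
      have := hH v
      rw [e1]
      linarith


theorem lemma_dual_hessian
    {n p r : ℕ} (hn : 0 < n) (hp : 0 < p) (hr : 0 < r)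
    (A : Matrix (Fin n) (Fin n) ℝ) (hA : A.IsSymm)
    (Q : Fin p → Matrix (Fin n) (Fin n) ℝ) (hQ : ∀ i, (Q i).IsSymm)
    (B : Fin r → Matrix (Fin n) (Fin n) ℝ) (hB : ∀ i, (B i).IsSymm)
    (f : Fin n → ℝ) (d : Fin p → ℝ) (c : Fin r → ℝ)
    (β : ℝ) (hβ : 0 < β) (α : Fin r → ℝ) (hα : ∀ i, 0 < α i)
    (Prim : (Fin n → ℝ) → ℝ)
    (hPrim : Prim = fun x => (1/2) * (x ⬝ᵥ A.mulVec x) - f ⬝ᵥ x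
        + (1/β) * Real.log (1 + ∑ i, Real.exp (β * ((1/2) * (x ⬝ᵥ (Q i).mulVec x) + d i)))
        + ∑ i, (α i / 2) * ((1/2) * (x ⬝ᵥ (B i).mulVec x) + c i)^2)
    (Ga : ((Fin p ⊕ Fin r) → ℝ) → Matrix (Fin n) (Fin n) ℝ)
    (hGa : Ga = fun ζ => A + ∑ i, ζ (Sum.inl i) • Q i + ∑ i, ζ (Sum.inr i) • B i)
    (Dual : ((Fin p ⊕ Fin r) → ℝ) → ℝ)
    (hDual : Dual = fun ζ => -(1/2) * (f ⬝ᵥ (Ga ζ)⁻¹.mulVec f)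
        - ((1/β) * ((∑ i, ζ (Sum.inl i) * Real.log (ζ (Sum.inl i)))
            + (1 - ∑ i, ζ (Sum.inl i)) * Real.log (1 - ∑ i, ζ (Sum.inl i)))
          - ∑ i, d i * ζ (Sum.inl i))
        - (∑ i, (ζ (Sum.inr i))^2 / (2 * α i) - ∑ i, c i * ζ (Sum.inr i)))
    (zb : (Fin p ⊕ Fin r) → ℝ)
    (hpos : ∀ i, 0 < zb (Sum.inl i)) (hsum : ∑ i, zb (Sum.inl i) < 1)
    (hdet : (Ga zb).det ≠ 0)
    (hcrit1 : ∀ i, (1/2) * (f ⬝ᵥ ((Ga zb)⁻¹ * Q i * (Ga zb)⁻¹).mulVec f) + d i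
        = (1/β) * Real.log (zb (Sum.inl i) / (1 - ∑ j, zb (Sum.inl j))))
    (hcrit2 : ∀ i, (1/2) * (f ⬝ᵥ ((Ga zb)⁻¹ * B i * (Ga zb)⁻¹).mulVec f) + c i
        = zb (Sum.inr i) / α i)
    (xb : Fin n → ℝ) (hxb : xb = (Ga zb)⁻¹.mulVec f)
    (hmn : n < p + r)
    (hnegdef : ∀ x : Fin n → ℝ, x ≠ 0 → x ⬝ᵥ (Ga zb).mulVec x < 0)
    (hmin : IsLocalMin Prim xb)
    (F : Matrix (Fin n) (Fin p ⊕ Fin r) ℝ)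
    (hF : F = Matrix.of fun i j =>
        (Sum.elim (fun k => (Q k).mulVec xb) (fun k => (B k).mulVec xb) j) i)
    (D : Matrix (Fin p ⊕ Fin r) (Fin p ⊕ Fin r) ℝ)
    (hD : D = Matrix.fromBlocks
        (β • (Matrix.diagonal (fun i => zb (Sum.inl i))
            - Matrix.vecMulVec (fun i => zb (Sum.inl i)) (fun i => zb (Sum.inl i))))
        0 0 (Matrix.diagonal α)) :
    ∃ P : Matrix (Fin p ⊕ Fin r) (Fin n) ℝ, P.rank = n ∧
      (Pᵀ * (-(Fᵀ * (Ga zb)⁻¹ * F) - D⁻¹) * P).PosSemidef := by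
  have hT : 0 < 1 - ∑ i, zb (Sum.inl i) := by linarith
  have hGs : (Ga zb).IsSymm := by
    rw [hGa, Matrix.IsSymm]
    simp [transpose_sum, hA.eq, fun i => (hQ i).eq, fun i => (hB i).eq]
  have hGi : ((Ga zb)⁻¹)ᵀ = (Ga zb)⁻¹ := by rw [transpose_nonsing_inv, hGs.eq]
  have hval : ∀ M : Matrix (Fin n) (Fin n) ℝ,
      f ⬝ᵥ ((Ga zb)⁻¹ * M * (Ga zb)⁻¹).mulVec f = xb ⬝ᵥ M.mulVec xb := by
    intro M
    rw [Matrix.mul_assoc, ← mulVec_mulVec, ← mulVec_mulVec, ← hxb, dotProduct_mulVec,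
      ← mulVec_transpose, hGi, ← hxb]
  have hDs : D.IsSymm := by
    rw [hD, Matrix.IsSymm, fromBlocks_transpose]
    simp [transpose_vecMulVec]
  have hDq : ∀ y : Fin p ⊕ Fin r → ℝ, D.mulVec y = Sum.elim
      (fun i => β * (zb (Sum.inl i) * (y (Sum.inl i) - ∑ k, zb (Sum.inl k) * y (Sum.inl k))))
      (fun i => α i * y (Sum.inr i)) := by
    intro y
    rw [hD, fromBlocks_mulVec]
    ext (i | i)
    · simp [smul_mulVec, sub_mulVec, mulVec_diagonal, vecMulVec_mulVec, dotProduct]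
      left; ring
    · simp [mulVec_diagonal]
  have hDdet : IsUnit D.det := by
    rw [isUnit_iff_ne_zero]
    intro h0
    obtain ⟨y, hy, hy0⟩ := Matrix.exists_mulVec_eq_zero_iff.mpr h0
    apply hy
    rw [hDq] at hy0
    have h1 : ∀ i, y (Sum.inl i) = ∑ k, zb (Sum.inl k) * y (Sum.inl k) := by
      intro i
      have := congrFun hy0 (Sum.inl i)
      simp [hβ.ne', (hpos i).ne'] at this
      linarith
    set s := ∑ k, zb (Sum.inl k) * y (Sum.inl k) with hs
    have h2 : s = (∑ k, zb (Sum.inl k)) * s := by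
      rw [Finset.sum_mul]
      conv_lhs => rw [hs]
      exact Finset.sum_congr rfl fun i _ => by rw [h1 i]
    have h3 : s = 0 := by
      have : (1 - ∑ i, zb (Sum.inl i)) * s = 0 := by linarith
      exact (mul_eq_zero.mp this).resolve_left hT.ne'
    ext (i | i)
    · simp [h1 i, h3]
    · have := congrFun hy0 (Sum.inr i)
      simpa [(hα i).ne'] using this
  refine inv_order (Ga zb) hGs hdet hnegdef F D hDs hDdet ?_
  intro v
  -- the local minimum along the line through xb with direction v
  have hline : IsLocalMin (fun t : ℝ => Prim (xb + t • v)) 0 := by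
    have hc : ContinuousAt (fun t : ℝ => xb + t • v) 0 := by fun_prop
    have h0 : xb + (0 : ℝ) • v = xb := by simp
    have : IsLocalMin Prim (xb + (0 : ℝ) • v) := by rw [h0]; exact hmin
    exact IsLocalMin.comp_continuous (g := fun t : ℝ => xb + t • v) this hc
  have hfun : (fun t : ℝ => Prim (xb + t • v)) = fun t : ℝ =>
      ((1/2) * (xb ⬝ᵥ A.mulVec xb) - f ⬝ᵥ xb) + (v ⬝ᵥ A.mulVec xb - f ⬝ᵥ v) * t
        + (v ⬝ᵥ A.mulVec v) * t ^ 2 / 2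
        + (1/β) * Real.log (1 + ∑ i, Real.exp (β * (((1/2) * (xb ⬝ᵥ (Q i).mulVec xb) + d i)
            + (v ⬝ᵥ (Q i).mulVec xb) * t + (v ⬝ᵥ (Q i).mulVec v) * t ^ 2 / 2)))
        + ∑ i, (α i / 2) * (((1/2) * (xb ⬝ᵥ (B i).mulVec xb) + c i)
            + (v ⬝ᵥ (B i).mulVec xb) * t + (v ⬝ᵥ (B i).mulVec v) * t ^ 2 / 2) ^ 2 := by
    funext t
    rw [hPrim]
    simp only [quad_line _ hA, quad_line _ (hQ _), quad_line _ (hB _), dotProduct_add,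
      dotProduct_smul, smul_eq_mul]
    congr 1
    · congr 1
      · ring
      · congr 3
        exact Finset.sum_congr rfl fun i _ => by congr 1; ring
    · exact Finset.sum_congr rfl fun i _ => by congr 2; ring
  rw [hfun] at hline
  have hmain := second_order_line β hβ α _ _ _ _ _ _ _ _ _ hline _ rfl
  set T := 1 - ∑ i, zb (Sum.inl i) with hTdef
  have hexp : ∀ i, Real.exp (β * ((1/2) * (xb ⬝ᵥ (Q i).mulVec xb) + d i)) = zb (Sum.inl i) / T := by
    intro i
    rw [← hval, hcrit1 i, ← mul_assoc, mul_one_div_cancel hβ.ne', one_mul,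
      Real.exp_log (div_pos (hpos i) hT)]
  have hu : ∀ i, (1/2) * (xb ⬝ᵥ (B i).mulVec xb) + c i = zb (Sum.inr i) / α i := by
    intro i
    rw [← hval, hcrit2 i]
  have hS : 1 + ∑ i, zb (Sum.inl i) / T = 1 / T := by
    rw [← Finset.sum_div]
    field_simp
    rw [hTdef]; ring
  simp only [hexp, hu, hS] at hmain
  have hFv : ∀ j, (Fᵀ.mulVec v) j
      = Sum.elim (fun k => v ⬝ᵥ (Q k).mulVec xb) (fun k => v ⬝ᵥ (B k).mulVec xb) j := by
    intro j
    rw [hF]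
    rcases j with j | j <;> simp [mulVec, dotProduct, mul_comm]
  have hquad : v ⬝ᵥ (F * D * Fᵀ).mulVec v
      = β * (∑ i, zb (Sum.inl i) * (v ⬝ᵥ (Q i).mulVec xb) ^ 2
          - (∑ i, zb (Sum.inl i) * (v ⬝ᵥ (Q i).mulVec xb)) ^ 2)
        + ∑ i, α i * (v ⬝ᵥ (B i).mulVec xb) ^ 2 := by
    rw [Matrix.mul_assoc, ← mulVec_mulVec, ← mulVec_mulVec, dotProduct_mulVec,
      ← mulVec_transpose, hDq]
    set y := Fᵀ.mulVec v with hy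
    rw [dotProduct, Fintype.sum_sum_type]
    simp only [hFv, Sum.elim_inl, Sum.elim_inr]
    set s := ∑ i, zb (Sum.inl i) * (v ⬝ᵥ (Q i).mulVec xb) with hs
    congr 1
    · have : s ^ 2 = ∑ i, zb (Sum.inl i) * (v ⬝ᵥ (Q i).mulVec xb) * s := by
        rw [← Finset.sum_mul, ← hs, sq]
      rw [this, ← Finset.sum_sub_distrib, Finset.mul_sum]
      exact Finset.sum_congr rfl fun i _ => by ring
    · exact Finset.sum_congr rfl fun i _ => by ring
  have hGv : v ⬝ᵥ (Ga zb).mulVec v = v ⬝ᵥ A.mulVec v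
      + ∑ i, zb (Sum.inl i) * (v ⬝ᵥ (Q i).mulVec v)
      + ∑ i, zb (Sum.inr i) * (v ⬝ᵥ (B i).mulVec v) := by
    rw [hGa]
    simp only [add_mulVec, Matrix.sum_mulVec, dotProduct_add, dotProduct_sum, smul_mulVec,
      dotProduct_smul, smul_eq_mul]
  rw [hquad, hGv]
  refine hmain.trans_eq ?_
  have k1 : ∑ i, zb (Sum.inl i) / T * (β * (v ⬝ᵥ (Q i).mulVec xb) ^ 2 + v ⬝ᵥ (Q i).mulVec v)
      = (β * ∑ i, zb (Sum.inl i) * (v ⬝ᵥ (Q i).mulVec xb) ^ 2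
        + ∑ i, zb (Sum.inl i) * (v ⬝ᵥ (Q i).mulVec v)) / T := by
    rw [Finset.mul_sum, ← Finset.sum_add_distrib, Finset.sum_div]
    exact Finset.sum_congr rfl fun i _ => by ring
  have k2 : ∑ i, zb (Sum.inl i) / T * (v ⬝ᵥ (Q i).mulVec xb)
      = (∑ i, zb (Sum.inl i) * (v ⬝ᵥ (Q i).mulVec xb)) / T := by
    rw [Finset.sum_div]
    exact Finset.sum_congr rfl fun i _ => by ring
  have k3 : ∑ i, α i * ((v ⬝ᵥ (B i).mulVec xb) ^ 2 + zb (Sum.inr i) / α i * (v ⬝ᵥ (B i).mulVec v))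
      = ∑ i, α i * (v ⬝ᵥ (B i).mulVec xb) ^ 2
        + ∑ i, zb (Sum.inr i) * (v ⬝ᵥ (B i).mulVec v) := by
    rw [← Finset.sum_add_distrib]
    refine Finset.sum_congr rfl fun i _ => ?_
    have := (hα i).ne'
    field_simp
  rw [k1, k2, k3]
  have hT0 : T ≠ 0 := hT.ne'
  field_simp
  ring
end
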